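/- arXiv:2007.04261 — 3 statements merged into one kernel-verified Lean document; each statement's English description precedes it below -/
import Mathlib

section
/- Let d, c, n be natural numbers with c ≥ 1, d ≥ 4c and n ≥ 1. Let V be a finite set with |V| = n and let 𝓕 be a family of subsets of V satisfying d·|𝓕| ≤ n·(2^d − c). Then there exists a vertex x ∈ V such that |𝓕_x| ≥ |𝓕| − (2^{d−1} − c). -/
/-- The trace of a family `𝓕` at a vertex `x`: the family `{F \ {x} : F ∈ 𝓕}`. -/
def traceAt {α : Type*} [DecidableEq α] (𝓕 : Finset (Finset α)) (x : α) :
    Finset (Finset α) :=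
  𝓕.image fun F => F.erase x


section Aux

open Finset

/-- binary digit sum -/
def pcnt : ℕ → ℕ
  | 0 => 0
  | n + 1 => (n + 1) % 2 + pcnt ((n + 1) / 2)
decreasing_by omega

lemma pcnt_two_mul (n : ℕ) : pcnt (2 * n) = pcnt n := by
  cases n with
  | zero => rfl
  | succ n =>
    rw [show 2 * (n + 1) = (2 * n + 1) + 1 by ring, pcnt]
    rw [show (2 * n + 1 + 1) % 2 = 0 by omega, show (2 * n + 1 + 1) / 2 = n + 1 by omega]
    simp

lemma pcnt_two_mul_add_one (n : ℕ) : pcnt (2 * n + 1) = pcnt n + 1 := by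
  rw [pcnt]
  rw [show (2 * n + 1) % 2 = 1 by omega, show (2 * n + 1) / 2 = n by omega]
  omega

def sh (f : ℕ → ℚ) : ℕ → ℚ := fun k => f (k + 1)

lemma sh_anti {f : ℕ → ℚ} (hf : Antitone f) : Antitone (sh f) :=
  fun _ _ h => hf (Nat.succ_le_succ h)

def KK (f : ℕ → ℚ) (m : ℕ) : ℚ := ∑ i ∈ range m, f (pcnt i)

lemma KK_zero (f : ℕ → ℚ) : KK f 0 = 0 := rfl

lemma KK_succ (f : ℕ → ℚ) (m : ℕ) : KK f (m + 1) = KK f m + f (pcnt m) := sum_range_succ _ _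

lemma KK_two_mul (f : ℕ → ℚ) (m : ℕ) : KK f (2 * m) = KK f m + KK (sh f) m := by
  induction m with
  | zero => simp [KK]
  | succ m ih =>
    rw [show 2 * (m + 1) = (2 * m + 1) + 1 by ring, KK_succ, KK_succ, ih, KK_succ, KK_succ,
      pcnt_two_mul, pcnt_two_mul_add_one, sh]
    ring

lemma KK_two_mul_add_one (f : ℕ → ℚ) (m : ℕ) :
    KK f (2 * m + 1) = KK f (m + 1) + KK (sh f) m := by
  rw [KK_succ, KK_two_mul, KK_succ, pcnt_two_mul]; ring

lemma KK_super : ∀ (a b : ℕ) (f : ℕ → ℚ), Antitone f → b ≤ a →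
    KK f (a + b) ≤ KK f a + KK (sh f) b := by
  intro a
  induction a using Nat.strong_induction_on with
  | _ a ih =>
  intro b f hf hb
  rcases Nat.eq_zero_or_pos b with rfl | hb0
  · simp [KK_zero]
  rcases eq_or_ne a b with rfl | hab
  · rw [← two_mul, KK_two_mul]
  have hsf := sh_anti hf
  rcases Nat.even_or_odd' a with ⟨p, rfl | rfl⟩ <;> rcases Nat.even_or_odd' b with ⟨q, rfl | rfl⟩
  · have h1 := ih p (by omega) q f hf (by omega)
    have h2 := ih p (by omega) q _ hsf (by omega)
    rw [← mul_add, KK_two_mul, KK_two_mul, KK_two_mul]; linarith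
  · have h1 := ih p (by omega) (q + 1) f hf (by omega)
    have h2 := ih p (by omega) q _ hsf (by omega)
    rw [show 2 * p + (2 * q + 1) = 2 * (p + q) + 1 by ring, KK_two_mul_add_one, KK_two_mul,
      KK_two_mul_add_one, add_assoc]; linarith
  · have h1 := ih (p + 1) (by omega) q f hf (by omega)
    have h2 := ih p (by omega) q _ hsf (by omega)
    rw [show 2 * p + 1 + 2 * q = 2 * (p + q) + 1 by ring, KK_two_mul_add_one, KK_two_mul,
      KK_two_mul_add_one, show p + q + 1 = p + 1 + q by ring]; linarith
  · have h1 := ih (p + 1) (by omega) q f hf (by omega)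
    have h2 := ih p (by omega) (q + 1) _ hsf (by omega)
    have h3 : KK (sh (sh f)) (q + 1) = KK (sh (sh f)) q + sh (sh f) (pcnt q) := KK_succ _ _
    have h4 : KK (sh f) (q + 1) = KK (sh f) q + sh f (pcnt q) := KK_succ _ _
    have h5 : sh (sh f) (pcnt q) ≤ sh f (pcnt q) := hsf (Nat.le_succ _)
    rw [show 2 * p + 1 + (2 * q + 1) = 2 * (p + 1 + q) by ring, KK_two_mul, KK_two_mul_add_one,
      KK_two_mul_add_one]
    rw [← add_assoc, add_right_comm p q 1] at h2
    linarith

variable {α : Type*} [DecidableEq α]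

def WW (f : ℕ → ℚ) (L : Finset (Finset α)) : ℚ := ∑ S ∈ L, f S.card

lemma WW_split (f : ℕ → ℚ) (L : Finset (Finset α)) (a : α) :
    WW f L = WW f (L.nonMemberSubfamily a) + WW (sh f) (L.memberSubfamily a) := by
  unfold WW
  rw [← sum_filter_add_sum_filter_not L (fun s => a ∈ s), ← image_insert_memberSubfamily,
    sum_image, add_comm]
  · congr 1
    apply sum_congr rfl
    intro s hs
    rw [mem_memberSubfamily] at hs
    rw [card_insert_of_notMem hs.2]; rfl
  · intro s hs t ht h
    simp only [mem_coe, mem_memberSubfamily] at hs ht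
    rw [← erase_insert hs.2, ← erase_insert ht.2]
    rw [h]

theorem katona (L : Finset (Finset α)) : ∀ f : ℕ → ℚ, Antitone f → IsLowerSet (L : Set (Finset α)) →
    KK f L.card ≤ WW f L := by
  induction L using Finset.memberFamily_induction_on with
  | empty => intro f _ _; simp [KK, WW]
  | singleton_empty => intro f _ _; simp [KK, WW, pcnt]
  | @subfamily a L h0 h1 =>
    intro f hf hL
    rw [WW_split f L a, ← card_memberSubfamily_add_card_nonMemberSubfamily a L, add_comm]
    refine (KK_super _ _ f hf (card_le_card hL.memberSubfamily_subset_nonMemberSubfamily)).trans ?_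
    exact add_le_add (h0 f hf hL.nonMemberSubfamily) (h1 _ (sh_anti hf) hL.memberSubfamily)

lemma KK_pow (f : ℕ → ℚ) (k : ℕ) : KK f (2 ^ k) = ∑ j ∈ range (k + 1), (k.choose j : ℚ) * f j := by
  have h : ∀ f : ℕ → ℚ, KK f (2 ^ k) = ∑ S ∈ (range k).powerset, f S.card := by
    induction k with
    | zero => intro f; simp [KK, pcnt]
    | succ k ih =>
      intro f
      rw [pow_succ', KK_two_mul, ih, ih, range_add_one, sum_powerset_insert (by simp)]
      congr 1
      apply sum_congr rfl
      intro S hS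
      rw [card_insert_of_notMem, sh]
      intro h
      have := mem_powerset.1 hS h
      simp at this
  rw [h, sum_powerset_apply_card]
  simp

def ff : ℕ → ℚ := fun k => 1 / ((k : ℚ) + 1)

lemma ff_anti : Antitone ff := by
  intro a b h
  unfold ff
  have : (a : ℚ) ≤ b := by exact_mod_cast h
  gcongr

lemma ff_pos (k : ℕ) : 0 < ff k := by unfold ff; positivity

lemma choose_ff (k : ℕ) : ∑ j ∈ range (k + 1), (k.choose j : ℚ) * ff j = (2 ^ (k + 1) - 1) / (k + 1) := by
  have h : ∀ j ∈ range (k + 1), (k.choose j : ℚ) * ff j = ((k + 1).choose (j + 1) : ℚ) / (k + 1) := by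
    intro j _
    have := Nat.add_one_mul_choose_eq k j
    have h2 : ((k : ℚ) + 1) * k.choose j = (k + 1).choose (j + 1) * (j + 1) := by exact_mod_cast this
    unfold ff
    field_simp
    linarith
  rw [sum_congr rfl h, ← sum_div]
  congr 1
  have := Nat.sum_range_choose (k + 1)
  rw [sum_range_succ'] at this
  simp at this
  have h3 : ((∑ j ∈ range (k + 1), (k + 1).choose (j + 1) : ℕ) : ℚ) + 1 = 2 ^ (k + 1) := by
    exact_mod_cast this
  push_cast at h3
  linarith

lemma KK_ff_pow (k : ℕ) : KK ff (2 ^ k) = (2 ^ (k + 1) - 1) / (k + 1) := by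
  rw [KK_pow, choose_ff]

lemma sum_powerset_ff {α : Type*} (E : Finset α) :
    ∑ S ∈ E.powerset, ff S.card = (2 ^ (E.card + 1) - 1) / (E.card + 1) := by
  rw [sum_powerset_apply_card, ← choose_ff]
  simp

lemma KK_mono {f : ℕ → ℚ} (hf : ∀ k, 0 ≤ f k) {a b : ℕ} (h : a ≤ b) : KK f a ≤ KK f b :=
  sum_le_sum_of_subset_of_nonneg (range_mono h) (fun _ _ _ => hf _)

lemma pcnt_top (k : ℕ) : ∀ j, j < 2 ^ k → k ≤ pcnt (2 ^ k - 1 - j) + j := by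
  induction k with
  | zero => intro j _; omega
  | succ k ih =>
    intro j hj
    rw [pow_succ'] at hj ⊢
    rcases Nat.even_or_odd' j with ⟨i, rfl | rfl⟩
    · have := ih i (by omega)
      rw [show 2 * 2 ^ k - 1 - 2 * i = 2 * (2 ^ k - 1 - i) + 1 by omega, pcnt_two_mul_add_one]
      omega
    · have := ih i (by omega)
      rw [show 2 * 2 ^ k - 1 - (2 * i + 1) = 2 * (2 ^ k - 1 - i) by omega, pcnt_two_mul]
      omega

/-- removing `t` top elements -/
lemma KK_top (k t e : ℕ) (ht : t ≤ 2 ^ k) (hte : t ≤ e + 1) (he : e ≤ k) :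
    KK ff (2 ^ k) - t * (1 / ((k : ℚ) + 1 - e)) ≤ KK ff (2 ^ k - t) := by
  induction t with
  | zero => simp
  | succ t ih =>
    have h1 := ih (by omega) (by omega)
    have h2 : 2 ^ k - t = (2 ^ k - (t + 1)) + 1 := by omega
    rw [h2, KK_succ] at h1
    have h3 := pcnt_top k t (by omega)
    rw [show 2 ^ k - 1 - t = 2 ^ k - (t + 1) by omega] at h3
    have h4 : ff (pcnt (2 ^ k - (t + 1))) ≤ 1 / ((k : ℚ) + 1 - e) := by
      unfold ff
      have : (k : ℚ) ≤ pcnt (2 ^ k - (t + 1)) + e := by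
        have : k ≤ pcnt (2 ^ k - (t + 1)) + e := by omega
        exact_mod_cast this
      have h5 : (e : ℚ) ≤ k := by exact_mod_cast he
      apply one_div_le_one_div_of_le <;> linarith
    push_cast
    linarith

lemma KK_pow_add (j : ℕ) : ∀ (f : ℕ → ℚ) (r : ℕ), r ≤ 2 ^ j →
    KK f (2 ^ j + r) = KK f (2 ^ j) + KK (sh f) r := by
  induction j with
  | zero =>
    intro f r hr
    have : r = 0 ∨ r = 1 := by simp at hr; omega
    rcases this with rfl | rfl
    · simp [KK_zero]
    · rw [pow_zero, ← KK_two_mul]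
      rfl
  | succ j ih =>
    intro f r hr
    rw [pow_succ'] at hr ⊢
    rcases Nat.even_or_odd' r with ⟨q, rfl | rfl⟩
    · rw [← mul_add, KK_two_mul, KK_two_mul, KK_two_mul, ih _ q (by omega), ih _ q (by omega)]
      ring
    · rw [← add_assoc, ← mul_add, KK_two_mul_add_one, KK_two_mul, KK_two_mul_add_one, add_assoc,
        ih _ (q + 1) (by omega), ih _ q (by omega)]
      ring

lemma KK_merge_aux {g : ℕ → ℚ} (hg : Antitone g) {p q : ℕ} (hq : 1 ≤ q) (hpq : q ≤ p) :
    KK g (p + q) + (g 0 - g 1) ≤ KK g p + KK g q := by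
  have h1 := KK_super p q g hg hpq
  have h2 : g 0 - g 1 ≤ KK g q - KK (sh g) q := by
    unfold KK
    rw [← sum_sub_distrib]
    have h3 : ∀ i ∈ range q, 0 ≤ g (pcnt i) - sh g (pcnt i) := by
      intro i _
      have : sh g (pcnt i) ≤ g (pcnt i) := hg (Nat.le_succ _)
      linarith
    have h4 := single_le_sum h3 (mem_range.2 hq)
    simpa [pcnt, sh] using h4
  linarith

lemma KK_merge {g : ℕ → ℚ} (hg : Antitone g) {p q : ℕ} (hp : 1 ≤ p) (hq : 1 ≤ q) :
    KK g (p + q) + (g 0 - g 1) ≤ KK g p + KK g q := by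
  rcases le_total q p with h | h
  · exact KK_merge_aux hg hq h
  · have := KK_merge_aux hg hp h
    rw [add_comm q p] at this
    linarith

lemma KK_neg (k : ℕ) : KK (fun j => -(j : ℚ)) (2 ^ k) = -(k * 2 ^ k / 2) := by
  have hs : ∀ m, KK (sh (fun j => -(j : ℚ))) m = KK (fun j => -(j : ℚ)) m - m := by
    intro m
    unfold KK sh
    simp [sum_add_distrib]
    ring
  induction k with
  | zero => simp [KK, pcnt]
  | succ k ih =>
    rw [pow_succ', KK_two_mul, hs, ih]
    push_cast
    ring

lemma card_member (L : Finset (Finset α)) (u : α) :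
    (L.memberSubfamily u).card = (L.filter (fun S => u ∈ S)).card := by
  have h1 := card_memberSubfamily_add_card_nonMemberSubfamily u L
  have h2 := card_filter_add_card_filter_not (s := L) (fun S => u ∈ S)
  unfold nonMemberSubfamily at h1
  omega

lemma sum_member_le (L : Finset (Finset α)) (U : Finset α) :
    ∑ u ∈ U, (L.memberSubfamily u).card ≤ ∑ S ∈ L, S.card := by
  simp_rw [card_member, card_filter]
  rw [sum_comm]
  apply sum_le_sum
  intro S _
  rw [← card_filter]
  apply card_le_card
  intro u hu
  exact (mem_filter.1 hu).2

lemma sq_lt_two_pow (d : ℕ) (h : 8 ≤ d) : d * d < 2 ^ d := by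
  induction d, h using Nat.le_induction with
  | base => norm_num
  | succ d hd ih => rw [pow_succ]; nlinarith

lemma big_link (d c : ℕ) (hc : 1 ≤ c) (hd : 4 * c ≤ d) (L : Finset (Finset α))
    (hL : IsLowerSet (L : Set (Finset α))) (hcard : 2 ^ (d - 1) < L.card + c)
    (U : Finset α) (hU : 2 ^ (d - 1) ≤ L.card ∨ (d ≤ U.card ∧ ∀ u ∈ U, {u} ∈ L)) :
    ((2 : ℚ) ^ d - c) / d ≤ WW ff L := by
  obtain ⟨k, rfl⟩ : ∃ k, d = k + 2 := ⟨d - 2, by omega⟩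
  rw [show k + 2 - 1 = k + 1 by omega] at *
  have hcQ : (1 : ℚ) ≤ c := by exact_mod_cast hc
  have hkQ : (0 : ℚ) ≤ k := by positivity
  have hpow := KK_ff_pow (k + 1)
  push_cast at hpow
  by_cases hbig : 2 ^ (k + 1) ≤ L.card
  · have h1 := katona L ff ff_anti hL
    have h2 := KK_mono (fun k => (ff_pos k).le) hbig
    rw [hpow] at h2
    refine le_trans ?_ (h2.trans h1)
    push_cast
    rw [show (k : ℚ) + 1 + 1 = k + 2 by ring]
    gcongr
  · obtain ⟨hUc, hUm⟩ := hU.resolve_left hbig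
    obtain ⟨t, ht⟩ : ∃ t, t = 2 ^ (k + 1) - L.card := ⟨_, rfl⟩
    have ht1 : 1 ≤ t := by omega
    have htc : t + 1 ≤ c := by omega
    have hLt : L.card + t = 2 ^ (k + 1) := by omega
    have hsq := sq_lt_two_pow (k + 2) (by omega)
    have htk : (k + 2) * t < 2 ^ k := by
      have : (k + 2) * (4 * t) ≤ (k + 2) * (k + 2) := Nat.mul_le_mul_left _ (by omega)
      have h2 : 2 ^ (k + 2) = 4 * 2 ^ k := by ring
      nlinarith
    have hex : ∃ v ∈ U, (L.memberSubfamily v).card + t + 1 ≤ 2 ^ k := by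
      by_contra! hcon
      obtain ⟨U', hU', hcU'⟩ := exists_subset_card_eq hUc
      have h1 : ∑ u ∈ U', 2 ^ k ≤ ∑ u ∈ U', ((L.memberSubfamily u).card + t) := by
        apply sum_le_sum
        intro u hu
        have := hcon u (hU' hu)
        omega
      rw [sum_add_distrib] at h1
      simp only [sum_const, hcU', smul_eq_mul] at h1
      have h2 := sum_member_le L U'
      have h3 := katona L (fun j => -(j : ℚ))
        (fun a b h => by simp only [neg_le_neg_iff]; exact_mod_cast h) hL
      have h4 : KK (fun j => -(j : ℚ)) (2 ^ (k + 1)) ≤ KK (fun j => -(j : ℚ)) L.card := by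
        rw [← hLt]
        unfold KK
        rw [sum_range_add]
        have : ∑ x ∈ range t, -((pcnt (L.card + x) : ℕ) : ℚ) ≤ 0 :=
          sum_nonpos (fun i _ => by simp)
        linarith
      rw [KK_neg] at h4
      have h5 : WW (fun j => -(j : ℚ)) L = -((∑ S ∈ L, S.card : ℕ) : ℚ) := by
        unfold WW
        push_cast
        rw [sum_neg_distrib]
      rw [h5] at h3
      have h6 : ((∑ S ∈ L, S.card : ℕ) : ℚ) ≤ ((k + 1) * 2 ^ k : ℕ) := by
        push_cast
        push_cast at h4 h3
        rw [pow_succ] at h4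
        linarith
      have h7 : ∑ S ∈ L, S.card ≤ (k + 1) * 2 ^ k := by exact_mod_cast h6
      nlinarith
    obtain ⟨v, hvU, hv⟩ := hex
    have hb1 : 1 ≤ (L.memberSubfamily v).card := by
      rw [Nat.one_le_iff_ne_zero, card_ne_zero]
      exact ⟨∅, by simpa using hUm v hvU⟩
    have hab := card_memberSubfamily_add_card_nonMemberSubfamily v L
    have hW := WW_split ff L v
    have hk0 := katona _ ff ff_anti (hL.nonMemberSubfamily (a := v))
    have hk1 := katona _ (sh ff) (sh_anti ff_anti) (hL.memberSubfamily (a := v))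
    set b := (L.memberSubfamily v).card with hb
    have hp : 2 ^ (k + 1) = 2 ^ k + 2 ^ k := by ring
    obtain ⟨a', ha'⟩ : ∃ a', (L.nonMemberSubfamily v).card = 2 ^ k + a' :=
      ⟨(L.nonMemberSubfamily v).card - 2 ^ k, by omega⟩
    rw [ha', KK_pow_add k ff a' (by omega)] at hk0
    have hm := KK_merge (sh_anti ff_anti) (p := a') (q := b) (by omega) hb1
    have hj := KK_pow_add k ff (a' + b) (by omega)
    have htop := KK_top (k + 1) t t (by omega) (by omega) (by omega)
    rw [show 2 ^ (k + 1) - t = 2 ^ k + (a' + b) by omega, hj, hpow] at htop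
    have h6 : sh ff 0 - sh ff 1 = 1 / 6 := by unfold sh ff; norm_num
    rw [h6] at hm
    have hfin : (t : ℚ) * (1 / ((k : ℚ) + 1 + 1 - t)) ≤ 1 / 6 + t / (k + 2) := by
      have h4 : 4 * (t : ℚ) ≤ k + 2 := by
        have : 4 * t ≤ k + 2 := by omega
        exact_mod_cast this
      have hpos : (0 : ℚ) < k + 1 + 1 - t := by linarith
      have ht0 : (0 : ℚ) ≤ t := by positivity
      rw [mul_one_div, div_add_div _ _ (by norm_num) (by positivity), div_le_div_iff₀ hpos (by positivity)]
      nlinarith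
    have hcd : ((2 : ℚ) ^ (k + 2) - c) / ((k + 2 : ℕ) : ℚ) + t / (k + 2) ≤
        (2 ^ (k + 1 + 1) - 1) / ((k : ℚ) + 1 + 1) := by
      push_cast
      rw [← add_div, show (k : ℚ) + 1 + 1 = k + 2 by ring]
      have : (t : ℚ) + 1 ≤ c := by exact_mod_cast htc
      gcongr
      linarith
    push_cast at htop
    linarith

lemma trace_compression_le (𝓕 : Finset (Finset α)) (a x : α) :
    (traceAt (Down.compression a 𝓕) x).card ≤ (traceAt 𝓕 x).card := by
  by_cases hax : x = a
  · subst hax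
    apply card_le_card
    intro S hS
    simp only [traceAt, mem_image, Down.mem_compression] at hS ⊢
    obtain ⟨T, hT | hT, rfl⟩ := hS
    · exact ⟨T, hT.1, rfl⟩
    · exact ⟨_, hT.2, by rw [erase_insert_eq_erase]⟩
  · rw [← Down.card_compression a (traceAt 𝓕 x)]
    apply card_le_card
    intro S hS
    simp only [traceAt, mem_image] at hS
    obtain ⟨T, hT, rfl⟩ := hS
    rw [Down.mem_compression] at hT ⊢
    rcases hT with hT | hT
    · left
      refine ⟨mem_image.2 ⟨T, hT.1, rfl⟩, mem_image.2 ⟨_, hT.2, erase_right_comm⟩⟩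
    · have haT : a ∉ T := by
        intro h
        rw [insert_eq_of_mem h] at hT
        exact hT.1 hT.2
      by_cases h : T.erase x ∈ traceAt 𝓕 x
      · left
        refine ⟨h, ?_⟩
        rwa [erase_eq_of_notMem (fun h => haT (mem_of_mem_erase h))]
      · right
        refine ⟨h, mem_image.2 ⟨_, hT.2, ?_⟩⟩
        rw [erase_insert_of_ne (Ne.symm hax)]

lemma exists_hereditary (V : Finset α) (𝓕 : Finset (Finset α)) (h𝓕 : 𝓕 ⊆ V.powerset) :
    ∃ F : Finset (Finset α), F ⊆ V.powerset ∧ F.card = 𝓕.card ∧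
      (∀ x, (traceAt F x).card ≤ (traceAt 𝓕 x).card) ∧ IsLowerSet (F : Set (Finset α)) := by
  have key : ∀ U : Finset α, U ⊆ V → ∃ F : Finset (Finset α), F ⊆ V.powerset ∧ F.card = 𝓕.card ∧
      (∀ x, (traceAt F x).card ≤ (traceAt 𝓕 x).card) ∧ ∀ a ∈ U, ∀ S ∈ F, S.erase a ∈ F := by
    intro U
    induction U using Finset.induction with
    | empty => intro _; exact ⟨𝓕, h𝓕, rfl, fun _ => le_rfl, by simp⟩
    | insert b U hb ih =>
      intro hU
      obtain ⟨F, h1, h2, h3, h4⟩ := ih ((subset_insert _ _).trans hU)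
      refine ⟨Down.compression b F, ?_, ?_, ?_, ?_⟩
      · intro S hS
        rw [Down.mem_compression] at hS
        rcases hS with hS | hS
        · exact h1 hS.1
        · exact mem_powerset.2 ((subset_insert _ _).trans (mem_powerset.1 (h1 hS.2)))
      · rw [Down.card_compression, h2]
      · exact fun x => (trace_compression_le F b x).trans (h3 x)
      · intro a ha S hS
        rcases eq_or_ne a b with rfl | hab
        · exact Down.erase_mem_compression_of_mem_compression hS
        have haU : a ∈ U := by simpa [hab] using ha
        rw [Down.mem_compression] at hS ⊢
        rcases hS with hS | hS
        · left
          refine ⟨h4 a haU _ hS.1, ?_⟩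
          rw [erase_right_comm]
          exact h4 a haU _ hS.2
        · have hbS : b ∉ S := by
            intro h
            rw [insert_eq_of_mem h] at hS
            exact hS.1 hS.2
          by_cases h : S.erase a ∈ F
          · left
            refine ⟨h, ?_⟩
            rwa [erase_eq_of_notMem (fun h => hbS (mem_of_mem_erase h))]
          · right
            refine ⟨h, ?_⟩
            rw [← erase_insert_of_ne (Ne.symm hab)]
            exact h4 a haU _ hS.2
  obtain ⟨F, h1, h2, h3, h4⟩ := key V subset_rfl
  refine ⟨F, h1, h2, h3, ?_⟩
  have h5 : ∀ (R T : Finset α), T ∈ F → T \ R ∈ F := by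
    intro R
    induction R using Finset.induction with
    | empty => intro T hT; simpa using hT
    | insert a R _ ih =>
      intro T hT
      rw [sdiff_insert]
      by_cases ha : a ∈ V
      · exact h4 a ha _ (ih T hT)
      · rw [erase_eq_of_notMem]
        · exact ih T hT
        · intro h
          exact ha (mem_powerset.1 (h1 hT) (mem_sdiff.1 h).1)
  intro T S hST hT
  have hST : S ⊆ T := hST
  have := h5 (T \ S) T hT
  rwa [Finset.sdiff_sdiff_eq_self hST] at this

lemma trace_card (F : Finset (Finset α)) (hF : IsLowerSet (F : Set (Finset α))) (x : α) :
    (traceAt F x).card + (F.filter (fun S => x ∈ S)).card = F.card := by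
  have h : traceAt F x = F.filter (fun S => x ∉ S) := by
    ext S
    simp only [traceAt, mem_image, mem_filter]
    constructor
    · rintro ⟨T, hT, rfl⟩
      exact ⟨hF (erase_subset _ _) hT, notMem_erase _ _⟩
    · rintro ⟨hS, hx⟩
      exact ⟨S, hS, erase_eq_of_notMem hx⟩
  rw [h, add_comm]
  exact card_filter_add_card_filter_not _

def wt (F : Finset (Finset α)) (x : α) : ℚ := ∑ S ∈ F.filter (fun S => x ∈ S), 1 / (S.card : ℚ)

lemma wt_eq (F : Finset (Finset α)) (x : α) : wt F x = WW ff (F.memberSubfamily x) := by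
  unfold wt WW
  rw [← image_insert_memberSubfamily, sum_image]
  · apply sum_congr rfl
    intro s hs
    rw [mem_memberSubfamily] at hs
    rw [card_insert_of_notMem hs.2]
    unfold ff
    push_cast
    rfl
  · intro s hs t ht h
    simp only [mem_coe, mem_memberSubfamily] at hs ht
    rw [← erase_insert hs.2, ← erase_insert ht.2]
    rw [h]

lemma sum_wt (G : Finset (Finset α)) (D : Finset α) (hG : ∀ S ∈ G, S ⊆ D) (h0 : ∅ ∈ G) :
    ∑ u ∈ D, wt G u = G.card - 1 := by
  unfold wt
  simp_rw [sum_filter]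
  rw [sum_comm]
  have h : ∀ S ∈ G, ∑ u ∈ D, (if u ∈ S then 1 / (S.card : ℚ) else 0) = if S = ∅ then 0 else 1 := by
    intro S hS
    rw [← sum_filter, sum_const, filter_mem_eq_inter, inter_eq_right.2 (hG S hS)]
    split_ifs with h
    · simp [h]
    · have : (S.card : ℚ) ≠ 0 := by
        exact_mod_cast card_ne_zero.2 (nonempty_iff_ne_empty.2 h)
      simp [this]
  rw [sum_congr rfl h, ← add_sum_erase _ _ h0, if_pos rfl]
  rw [sum_congr rfl (g := fun _ => (1 : ℚ)) (fun S hS => if_neg (ne_of_mem_erase hS))]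
  rw [sum_const, card_erase_of_mem h0, nsmul_eq_mul, Nat.cast_sub (card_pos.2 ⟨_, h0⟩)]
  simp

def nb (F : Finset (Finset α)) (V : Finset α) (x : α) : Finset α := V.filter (fun y => {x, y} ∈ F)

/-- restriction of the family to subsets of `D` -/
def rs (F : Finset (Finset α)) (D : Finset α) : Finset (Finset α) := F.filter (fun S => S ⊆ D)

structure Hyp (F : Finset (Finset α)) (V : Finset α) (d c : ℕ) : Prop where
  hF : IsLowerSet (F : Set (Finset α))
  hV : ∀ S ∈ F, S ⊆ V
  hc : 1 ≤ c
  hd : 4 * c ≤ d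
  hdeg : ∀ x ∈ V, 2 ^ (d - 1) < (F.filter (fun S => x ∈ S)).card + c

def Low (F : Finset (Finset α)) (d c : ℕ) (x : α) : Prop := wt F x < ((2 : ℚ) ^ d - c) / d

section
variable {F : Finset (Finset α)} {V : Finset α} {d c : ℕ}

lemma Hyp.down (H : Hyp F V d c) {S T : Finset α} (h : S ⊆ T) (hT : T ∈ F) : S ∈ F := H.hF h hT

lemma Hyp.self_mem (H : Hyp F V d c) {x : α} (hx : x ∈ V) : x ∈ nb F V x := by
  have h1 := H.hdeg x hx
  have h2 : d - 1 < 2 ^ (d - 1) := Nat.lt_two_pow_self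
  have h3 := H.hd
  have h4 := H.hc
  have : 0 < (F.filter (fun S => x ∈ S)).card := by omega
  obtain ⟨S, hS⟩ := card_pos.1 this
  rw [mem_filter] at hS
  refine mem_filter.2 ⟨hx, H.down ?_ hS.1⟩
  simpa using hS.2

lemma Hyp.sub_nb (H : Hyp F V d c) {S : Finset α} {x : α} (hS : S ∈ F) (hx : x ∈ S) :
    S ⊆ nb F V x := by
  intro y hy
  refine mem_filter.2 ⟨H.hV S hS hy, H.down ?_ hS⟩
  intro z hz
  simp only [mem_insert, mem_singleton] at hz
  rcases hz with rfl | rfl <;> assumption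

lemma member_sub (H : Hyp F V d c) (x : α) :
    F.memberSubfamily x ⊆ ((nb F V x).erase x).powerset := by
  intro S hS
  rw [mem_memberSubfamily] at hS
  rw [mem_powerset, subset_erase]
  exact ⟨(subset_insert _ _).trans (H.sub_nb hS.1 (mem_insert_self _ _)), hS.2⟩

lemma Hyp.low_card (H : Hyp F V d c) {x : α} (hx : x ∈ V) (hl : Low F d c x) :
    (nb F V x).card = d ∧ 2 ≤ c := by
  have hself := H.self_mem hx
  have hdeg := H.hdeg x hx
  rw [← card_member] at hdeg
  have hc := H.hc
  have hd := H.hd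
  have hbig := big_link d c H.hc H.hd (F.memberSubfamily x) H.hF.memberSubfamily hdeg
    ((nb F V x).erase x)
  rw [← wt_eq] at hbig
  have hno : ¬ (2 ^ (d - 1) ≤ (F.memberSubfamily x).card ∨ (d ≤ ((nb F V x).erase x).card ∧
      ∀ u ∈ (nb F V x).erase x, {u} ∈ F.memberSubfamily x)) := by
    intro h
    exact absurd (hbig h) (not_le.2 hl)
  push Not at hno
  have hcU : ((nb F V x).erase x).card + 1 = (nb F V x).card := card_erase_add_one hself
  have hle : ((nb F V x).erase x).card < d := by
    by_contra hcon
    obtain ⟨u, hu, hu'⟩ := hno.2 (not_lt.1 hcon)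
    apply hu'
    rw [mem_erase] at hu
    rw [mem_memberSubfamily]
    refine ⟨(mem_filter.1 hu.2).2, ?_⟩
    simpa using hu.1.symm
  have hcard := card_le_card (member_sub H x)
  rw [card_powerset] at hcard
  refine ⟨?_, by omega⟩
  by_contra hne
  have h1 : ((nb F V x).erase x).card ≤ d - 2 := by omega
  have h2 : 2 ^ ((nb F V x).erase x).card ≤ 2 ^ (d - 2) := Nat.pow_le_pow_right (by norm_num) h1
  have h3 : d - 2 < 2 ^ (d - 2) := Nat.lt_two_pow_self
  have h4 : 2 ^ (d - 1) = 2 * 2 ^ (d - 2) := by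
    rw [← pow_succ']
    congr 1
    omega
  omega

def miss (F : Finset (Finset α)) (D : Finset α) (x : α) : Finset (Finset α) :=
  (Icc {x} D).filter (fun S => S ∉ F)

lemma mem_miss {D : Finset α} {x : α} {S : Finset α} :
    S ∈ miss F D x ↔ x ∈ S ∧ S ⊆ D ∧ S ∉ F := by
  simp [miss, and_assoc]

lemma Hyp.miss_card (H : Hyp F V d c) {x : α} (hx : x ∈ V) {D : Finset α} (hD : nb F V x = D)
    (hcD : D.card = d) : (miss F D x).card + 1 ≤ c := by
  have h1 := card_filter_add_card_filter_not (s := Icc {x} D) (fun S => S ∈ F)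
  have hxD : x ∈ D := hD ▸ H.self_mem hx
  rw [card_Icc_finset (by simpa using hxD), card_singleton, hcD] at h1
  have h2 : (Icc {x} D).filter (fun S => S ∈ F) = F.filter (fun S => x ∈ S) := by
    ext S
    simp only [mem_filter, mem_Icc, singleton_subset_iff]
    constructor
    · rintro ⟨⟨h, _⟩, h'⟩
      exact ⟨h', h⟩
    · rintro ⟨h, h'⟩
      exact ⟨⟨h', hD ▸ H.sub_nb h h'⟩, h⟩
  rw [h2] at h1
  have := H.hdeg x hx
  unfold miss
  omega

lemma Hyp.low_small (H : Hyp F V d c) {x : α} (hx : x ∈ V) (hl : Low F d c x) {S : Finset α}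
    (hxS : x ∈ S) (hS : S ⊆ nb F V x) (hc3 : S.card ≤ 3) : S ∈ F := by
  by_contra hno
  obtain ⟨hcd, hc2⟩ := H.low_card hx hl
  have hm := H.miss_card hx rfl hcd
  have hsub : Icc S (nb F V x) ⊆ miss F (nb F V x) x := by
    intro T hT
    rw [mem_Icc] at hT
    exact mem_miss.2 ⟨hT.1 hxS, hT.2, fun h => hno (H.down hT.1 h)⟩
  have h1 := card_le_card hsub
  rw [card_Icc_finset hS, hcd] at h1
  have hd := H.hd
  have h2 : 2 ^ (d - 3) ≤ 2 ^ (d - S.card) := Nat.pow_le_pow_right (by norm_num) (by omega)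
  have h3 := sq_lt_two_pow d (by omega)
  have h4 : 2 ^ d = 8 * 2 ^ (d - 3) := by
    rw [show 8 = 2 ^ 3 by norm_num, ← pow_add]
    congr 1
    omega
  have h5 : d * 8 ≤ d * d := Nat.mul_le_mul_left _ (by omega)
  omega

lemma Hyp.nb_sub (H : Hyp F V d c) {x y : α} (hx : x ∈ V) (hl : Low F d c x)
    (hy : y ∈ nb F V x) : nb F V x ⊆ nb F V y := by
  intro z hz
  refine mem_filter.2 ⟨(mem_filter.1 hz).1, ?_⟩
  apply H.down (T := {x, y, z}) (by simp)
  apply H.low_small hx hl (by simp)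
  · intro w hw
    simp only [mem_insert, mem_singleton] at hw
    rcases hw with rfl | rfl | rfl
    · exact H.self_mem hx
    · exact hy
    · exact hz
  · exact card_le_three

lemma Hyp.nb_eq (H : Hyp F V d c) {x y : α} (hx : x ∈ V) (hl : Low F d c x)
    (hy : y ∈ nb F V x) (hly : Low F d c y) : nb F V x = nb F V y := by
  apply eq_of_subset_of_card_le (H.nb_sub hx hl hy)
  rw [(H.low_card hx hl).1, (H.low_card (mem_filter.1 hy).1 hly).1]

lemma Hyp.block (H : Hyp F V d c) {x : α} (hx : x ∈ V) (hl : Low F d c x) {D : Finset α}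
    (hD : nb F V x = D) :
    (2 : ℚ) ^ d - c ≤ (rs F D).card - 1 + ((D.filter (fun u => nb F V u ≠ D)).card : ℚ) / 2 := by
  obtain ⟨hcd, hc2⟩ := H.low_card hx hl
  rw [hD] at hcd
  have hxD : x ∈ D := hD ▸ H.self_mem hx
  have hd := H.hd
  have hDV : D ⊆ V := by rw [← hD]; exact filter_subset _ _
  set M := D.powerset.filter (fun S => S ∉ F) with hM
  have h1 : (rs F D).card + M.card = 2 ^ d := by
    have := card_filter_add_card_filter_not (s := D.powerset) (fun S => S ∈ F)
    rw [card_powerset, hcd] at this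
    rw [← this]
    congr 2
    ext S
    simp [rs, and_comm]
  have h1Q : ((rs F D).card : ℚ) + M.card = 2 ^ d := by exact_mod_cast h1
  have hmx := H.miss_card hx hD hcd
  by_cases hm : M.card + 1 ≤ c
  · have : (M.card : ℚ) + 1 ≤ c := by exact_mod_cast hm
    have h0 : (0 : ℚ) ≤ ((D.filter (fun u => nb F V u ≠ D)).card : ℚ) / 2 := by positivity
    linarith
  · have hM2 : M.card ≤ 2 * (miss F D x).card := by
      rw [← card_filter_add_card_filter_not (s := M) (fun S => x ∈ S), two_mul]
      apply add_le_add
      · apply card_le_card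
        intro S hS
        simp only [hM, mem_filter, mem_powerset] at hS
        exact mem_miss.2 ⟨hS.2, hS.1.1, hS.1.2⟩
      · apply card_le_card_of_injOn (fun S => insert x S)
        · intro S hS
          simp only [hM, coe_filter, mem_filter, mem_powerset, Set.mem_ofPred_eq] at hS
          refine mem_miss.2 ⟨mem_insert_self _ _, insert_subset hxD hS.1.1, fun h => hS.1.2 ?_⟩
          exact H.down (subset_insert _ _) h
        · intro s hs t ht h
          simp only [hM, coe_filter, mem_filter, mem_powerset, Set.mem_ofPred_eq] at hs ht
          rw [← erase_insert hs.2, ← erase_insert ht.2]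
          exact congrArg (fun z => z.erase x) h
    have hcl : ((D.filter (fun u => nb F V u = D)).erase x).card ≤ (miss F D x).card := by
      apply card_le_card_of_injOn (fun u => D.erase u)
      · intro u hu
        simp only [coe_erase, coe_filter, Set.mem_sdiff, Set.mem_ofPred_eq, Set.mem_singleton_iff] at hu
        refine mem_miss.2 ⟨mem_erase.2 ⟨fun h => hu.2 h.symm, hxD⟩, erase_subset _ _, ?_⟩
        intro hin
        have hmu := H.miss_card (hDV hu.1.1) hu.1.2 hcd
        apply hm
        refine le_trans ?_ hmu
        gcongr
        intro S hS
        simp only [hM, mem_filter, mem_powerset] at hS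
        refine mem_miss.2 ⟨?_, hS.1, hS.2⟩
        by_contra huS
        exact hS.2 (H.down (subset_erase.2 ⟨hS.1, huS⟩) hin)
      · intro u hu v hv h
        simp only [coe_erase, coe_filter, Set.mem_sdiff, Set.mem_ofPred_eq, Set.mem_singleton_iff] at hu hv
        by_contra hne
        have : u ∈ D.erase v := mem_erase.2 ⟨hne, hu.1.1⟩
        rw [← show D.erase u = D.erase v from h] at this
        simp at this
    have hcl2 := card_filter_add_card_filter_not (s := D) (fun u => nb F V u = D)
    have hcl3 := pred_card_le_card_erase (s := D.filter (fun u => nb F V u = D)) (a := x)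
    have hB : 2 * (c - 1) ≤ (D.filter (fun u => nb F V u ≠ D)).card := by
      simp only [ne_eq]
      omega
    have hBQ : (2 : ℚ) * (c - 1) ≤ (D.filter (fun u => nb F V u ≠ D)).card := by
      have : 2 * c ≤ (D.filter (fun u => nb F V u ≠ D)).card + 2 := by omega
      have : (2 : ℚ) * c ≤ (D.filter (fun u => nb F V u ≠ D)).card + 2 := by exact_mod_cast this
      linarith
    have hM3 : M.card + 2 ≤ 2 * c := by omega
    have hM3Q : (M.card : ℚ) + 2 ≤ 2 * c := by exact_mod_cast hM3
    linarith

lemma wt_rs_le {D : Finset α} {u : α} (hu : u ∈ D) (hcd : D.card = d) :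
    wt (rs F D) u ≤ ((2 : ℚ) ^ d - 1) / d := by
  have h := sum_powerset_ff (D.erase u)
  have hc := card_erase_add_one hu
  have hcQ : ((D.erase u).card : ℚ) + 1 = d := by rw [← hcd]; exact_mod_cast hc
  rw [hc, hcQ, hcd] at h
  rw [← h, wt_eq]
  unfold WW
  apply sum_le_sum_of_subset_of_nonneg
  · intro S hS
    rw [mem_memberSubfamily, rs, mem_filter] at hS
    rw [mem_powerset, subset_erase]
    exact ⟨(subset_insert _ _).trans hS.1.2, hS.2⟩
  · intro i _ _
    exact (ff_pos _).le

lemma Hyp.triples (H : Hyp F V d c) {a u : α} (ha : a ∈ V) (hl : Low F d c a)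
    (hu : u ∈ nb F V a) (hne : u ≠ a) :
    5 / 4 ≤ ∑ S ∈ F.filter (fun S => a ∈ S ∧ u ∈ S), 1 / (S.card : ℚ) := by
  obtain ⟨hcd, hc2⟩ := H.low_card ha hl
  have hd := H.hd
  set E := ((nb F V a).erase a).erase u with hE
  have hEc : E.card + 2 = d := by
    have h1 := card_erase_add_one (s := nb F V a) (H.self_mem ha)
    have h2 := card_erase_add_one (s := (nb F V a).erase a) (a := u) (mem_erase.2 ⟨hne, hu⟩)
    rw [← hE] at h2
    omega
  have hmem : ∀ t ∈ E, t ≠ u ∧ t ≠ a ∧ t ∈ nb F V a := by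
    intro t ht
    simpa [hE] using ht
  have h3 : ∀ t ∈ E, (({a, u, t} : Finset α)).card = 3 := by
    intro t ht
    obtain ⟨h1, h2, _⟩ := hmem t ht
    rw [card_eq_three]
    exact ⟨a, u, t, hne.symm, h2.symm, h1.symm, rfl⟩
  have hinj : Set.InjOn (fun t => ({a, u, t} : Finset α)) E := by
    intro s hs t ht h
    have hs' : s ∈ ({a, u, t} : Finset α) := by
      rw [← show ({a, u, s} : Finset α) = {a, u, t} from h]; simp
    obtain ⟨h1, h2, _⟩ := hmem s hs
    simpa [h1, h2] using hs'
  calc (5 / 4 : ℚ) ≤ ∑ t ∈ E, (1 / 3 : ℚ) := by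
        rw [sum_const, nsmul_eq_mul]
        have : 6 ≤ E.card := by omega
        have : (6 : ℚ) ≤ E.card := by exact_mod_cast this
        linarith
    _ = ∑ S ∈ E.image (fun t => ({a, u, t} : Finset α)), 1 / (S.card : ℚ) := by
        rw [sum_image hinj]
        apply sum_congr rfl
        intro t ht
        rw [h3 t ht]
        norm_num
    _ ≤ _ := by
        apply sum_le_sum_of_subset_of_nonneg
        · intro S hS
          obtain ⟨t, ht, rfl⟩ := mem_image.1 hS
          refine mem_filter.2 ⟨?_, by simp, by simp⟩
          apply H.low_small ha hl (by simp) _ (h3 t ht).le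
          intro w hw
          simp only [mem_insert, mem_singleton] at hw
          rcases hw with rfl | rfl | rfl
          · exact H.self_mem ha
          · exact hu
          · exact (hmem _ ht).2.2
        · intro i _ _
          positivity

open Classical in
noncomputable def blocks (F : Finset (Finset α)) (V : Finset α) (d c : ℕ) : Finset (Finset α) :=
  (V.filter (fun x => Low F d c x)).image (nb F V)

lemma mem_blocks {D : Finset α} :
    D ∈ blocks F V d c ↔ ∃ x, (x ∈ V ∧ Low F d c x) ∧ nb F V x = D := by
  simp [blocks]

lemma Hyp.vertex (H : Hyp F V d c) {u : α} (hu : u ∈ V) :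
    ∑ D ∈ (blocks F V d c).filter (fun D => u ∈ D),
      (wt (rs F D) u - ((2 : ℚ) ^ d - c) / d + if nb F V u ≠ D then 1 / 2 else 0)
      ≤ wt F u - ((2 : ℚ) ^ d - c) / d := by
  set Bu := (blocks F V d c).filter (fun D => u ∈ D) with hBu
  have : Nonempty α := ⟨u⟩
  have hch : ∀ D, ∃ a, D ∈ Bu → (a ∈ V ∧ Low F d c a) ∧ nb F V a = D := by
    intro D
    by_cases hD : D ∈ Bu
    · obtain ⟨a, ha⟩ := mem_blocks.1 (mem_filter.1 hD).1
      exact ⟨a, fun _ => ha⟩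
    · exact ⟨u, fun h => absurd h hD⟩
  choose a ha using hch
  have huD : ∀ D ∈ Bu, u ∈ D := fun D hD => (mem_filter.1 hD).2
  have hsplit : ∀ D, (F.filter (fun S => u ∈ S)).filter (fun S => S ⊆ D) =
      (rs F D).filter (fun S => u ∈ S) := by
    intro D
    unfold rs
    rw [filter_comm]
  have hsub : ∀ D, wt F u = wt (rs F D) u +
      ∑ S ∈ (F.filter (fun S => u ∈ S)).filter (fun S => ¬ S ⊆ D), 1 / (S.card : ℚ) := by
    intro D
    unfold wt
    rw [← sum_filter_add_sum_filter_not (F.filter (fun S => u ∈ S)) (fun S => S ⊆ D), hsplit]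
  rcases Bu.eq_empty_or_nonempty with hemp | ⟨D1, hD1⟩
  · rw [hemp, sum_empty]
    by_contra hlt
    have hl : Low F d c u := by unfold Low; linarith
    have : nb F V u ∈ Bu := mem_filter.2 ⟨mem_blocks.2 ⟨u, ⟨hu, hl⟩, rfl⟩, H.self_mem hu⟩
    rw [hemp] at this
    simp at this
  rw [← add_sum_erase _ _ hD1, hsub D1]
  rcases (Bu.erase D1).eq_empty_or_nonempty with hemp | hne
  · rw [hemp, sum_empty]
    split_ifs with hn
    · obtain ⟨⟨hxV, hxl⟩, hxD⟩ := ha D1 hD1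
      have hss : D1 ⊆ nb F V u := by
        have := H.nb_sub hxV hxl (y := u) (by rw [hxD]; exact huD D1 hD1)
        rwa [hxD] at this
      have : ¬ nb F V u ⊆ D1 := fun h => hn (h.antisymm hss)
      obtain ⟨z, hz, hzD⟩ := not_subset.1 this
      have hmem : ({u, z} : Finset α) ∈
          (F.filter (fun S => u ∈ S)).filter (fun S => ¬ S ⊆ D1) := by
        refine mem_filter.2 ⟨mem_filter.2 ⟨(mem_filter.1 hz).2, by simp⟩, ?_⟩
        intro h
        exact hzD (h (by simp))
      have h1 := single_le_sum (f := fun S : Finset α => 1 / (S.card : ℚ))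
        (fun i _ => by positivity) hmem
      have huz : u ≠ z := by
        rintro rfl
        exact hzD (huD D1 hD1)
      simp only [card_pair huz] at h1
      push_cast at h1
      linarith
    · have h0 : 0 ≤ ∑ S ∈ (F.filter (fun S => u ∈ S)).filter (fun S => ¬ S ⊆ D1),
          1 / (S.card : ℚ) := sum_nonneg (fun i _ => by positivity)
      linarith
  · -- at least two blocks
    have hkey : ∀ D ∈ Bu, ∀ D' ∈ Bu, a D ∈ D' → D = D' := by
      intro D hD D' hD' hm
      obtain ⟨⟨hxV, hxl⟩, hxD⟩ := ha D hD
      obtain ⟨⟨hxV', hxl'⟩, hxD'⟩ := ha D' hD'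
      have := H.nb_eq hxV' hxl' (y := a D) (by rw [hxD']; exact hm) hxl
      rw [← hxD, ← hxD', this]
    have hTb : ∀ D ∈ Bu.erase D1,
        (wt (rs F D) u - ((2 : ℚ) ^ d - c) / d + if nb F V u ≠ D then 1 / 2 else 0) ≤ 3 / 4 := by
      intro D hD
      have hDB := mem_of_mem_erase hD
      obtain ⟨⟨hxV, hxl⟩, hxD⟩ := ha D hDB
      have h1 := wt_rs_le (F := F) (huD D hDB) (hxD ▸ (H.low_card hxV hxl).1)
      have h2 : ((2 : ℚ) ^ d - 1) / d ≤ ((2 : ℚ) ^ d - c) / d + 1 / 4 := by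
        have hd := H.hd
        have hc := H.hc
        have hd0 : (0 : ℚ) < d := by
          have : 0 < d := by omega
          exact_mod_cast this
        have hdQ : (4 : ℚ) * c ≤ d := by exact_mod_cast hd
        rw [div_add_div _ _ hd0.ne' (by norm_num), div_le_div_iff₀ hd0 (by positivity)]
        nlinarith
      split_ifs <;> linarith
    have hT1 : (if nb F V u ≠ D1 then (1 / 2 : ℚ) else 0) ≤ 1 / 2 := by split_ifs <;> norm_num
    have hs1 := sum_le_sum hTb
    have hs2 : ∑ D ∈ Bu.erase D1, (5 / 4 : ℚ) ≤ ∑ D ∈ Bu.erase D1,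
        ∑ S ∈ F.filter (fun S => a D ∈ S ∧ u ∈ S), 1 / (S.card : ℚ) := by
      apply sum_le_sum
      intro D hD
      have hDB := mem_of_mem_erase hD
      obtain ⟨⟨hxV, hxl⟩, hxD⟩ := ha D hDB
      apply H.triples hxV hxl (by rw [hxD]; exact huD D hDB)
      intro h
      have := hkey D hDB D1 hD1 (h ▸ huD D1 hD1)
      exact ne_of_mem_erase hD this
    rw [← sum_biUnion] at hs2
    · have hs3 : ∑ S ∈ (Bu.erase D1).biUnion (fun D => F.filter (fun S => a D ∈ S ∧ u ∈ S)),
          1 / (S.card : ℚ) ≤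
          ∑ S ∈ (F.filter (fun S => u ∈ S)).filter (fun S => ¬ S ⊆ D1), 1 / (S.card : ℚ) := by
        apply sum_le_sum_of_subset_of_nonneg
        · intro S hS
          obtain ⟨D, hD, hS⟩ := mem_biUnion.1 hS
          obtain ⟨h1, h2, h3⟩ := mem_filter.1 hS
          refine mem_filter.2 ⟨mem_filter.2 ⟨h1, h3⟩, fun h => ?_⟩
          exact ne_of_mem_erase hD (hkey D (mem_of_mem_erase hD) D1 hD1 (h h2))
        · intro i _ _
          positivity
      have hs4 : (1 : ℚ) ≤ (Bu.erase D1).card := by exact_mod_cast card_pos.2 hne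
      rw [sum_const, nsmul_eq_mul] at hs1 hs2
      linarith
    · intro D hD D' hD' hne'
      rw [Function.onFun, disjoint_left]
      intro S hS hS'
      obtain ⟨h1, h2, h3⟩ := mem_filter.1 hS
      obtain ⟨h1', h2', h3'⟩ := mem_filter.1 hS'
      have hDB' := mem_of_mem_erase hD'
      obtain ⟨⟨hxV, hxl⟩, hxD⟩ := ha D' hDB'
      have hSD : S ⊆ D' := hxD ▸ H.sub_nb h1 h2'
      exact hne' (hkey D (mem_of_mem_erase hD) D' hDB' (hSD h2))

lemma Hyp.total (H : Hyp F V d c) (h0 : ∅ ∈ F) :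
    (V.card : ℚ) * (((2 : ℚ) ^ d - c) / d) ≤ F.card - 1 := by
  have h1 := sum_le_sum (fun u hu => H.vertex (u := u) hu)
  rw [sum_sub_distrib, sum_wt F V H.hV h0, sum_const, nsmul_eq_mul] at h1
  have h2 : 0 ≤ ∑ u ∈ V, ∑ D ∈ (blocks F V d c).filter (fun D => u ∈ D),
      (wt (rs F D) u - ((2 : ℚ) ^ d - c) / d + if nb F V u ≠ D then 1 / 2 else 0) := by
    simp_rw [sum_filter]
    rw [sum_comm]
    apply sum_nonneg
    intro D hD
    obtain ⟨x, ⟨hx, hl⟩, hxD⟩ := mem_blocks.1 hD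
    have hDV : D ⊆ V := by rw [← hxD]; exact filter_subset _ _
    obtain ⟨hcd, hc2⟩ := H.low_card hx hl
    rw [hxD] at hcd
    rw [← sum_filter, filter_mem_eq_inter, inter_eq_right.2 hDV, sum_add_distrib, sum_sub_distrib,
      sum_wt (rs F D) D (fun S hS => (mem_filter.1 hS).2) (mem_filter.2 ⟨h0, by simp⟩),
      sum_const, nsmul_eq_mul, ← sum_filter, sum_const, nsmul_eq_mul, hcd]
    have hb := H.block hx hl hxD
    have hd := H.hd
    have hd0 : (d : ℚ) ≠ 0 := by
      have : d ≠ 0 := by omega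
      exact_mod_cast this
    rw [mul_div_cancel₀ _ hd0]
    linarith
  linarith

end

end Aux

/-- Lower-bound direction of the main theorem: if `c ≥ 1`, `d ≥ 4c`, `n ≥ 1` and a family
`𝓕` of subsets of an `n`-set `V` has `d·|𝓕| ≤ n·(2^d − c)`, then some vertex `x ∈ V`
satisfies `|𝓕_x| ≥ |𝓕| − (2^{d−1} − c)`. -/
theorem trace_main_lower {α : Type*} [DecidableEq α] (d c n : ℕ)
    (hc : 1 ≤ c) (hd : 4 * c ≤ d) (hn : 1 ≤ n)
    (V : Finset α) (hV : V.card = n)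
    (𝓕 : Finset (Finset α)) (h𝓕 : 𝓕 ⊆ V.powerset)
    (hcount : (d : ℤ) * 𝓕.card ≤ (n : ℤ) * (2 ^ d - c)) :
    ∃ x ∈ V, (𝓕.card : ℤ) - (2 ^ (d - 1) - c) ≤ ((traceAt 𝓕 x).card : ℤ) := by
  by_contra! hcon
  obtain ⟨F, h1, h2, h3, h4⟩ := exists_hereditary V 𝓕 h𝓕
  have H : Hyp F V d c := by
    refine ⟨h4, fun S hS => Finset.mem_powerset.1 (h1 hS), hc, hd, ?_⟩
    intro x hx
    have e1 := hcon x hx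
    have e2 := h3 x
    have e3 := trace_card F h4 x
    have e4 : ((traceAt F x).card : ℤ) + (F.filter (fun S => x ∈ S)).card = 𝓕.card := by
      rw [← h2]
      exact_mod_cast e3
    have e5 : ((traceAt F x).card : ℤ) ≤ (traceAt 𝓕 x).card := by exact_mod_cast e2
    have e6 : (2 : ℤ) ^ (d - 1) < (F.filter (fun S => x ∈ S)).card + c := by linarith
    exact_mod_cast e6
  have h0 : ∅ ∈ F := by
    obtain ⟨x, hx⟩ := Finset.card_pos.1 (show 0 < V.card by omega)
    exact H.down (Finset.empty_subset _) (Finset.mem_filter.1 (H.self_mem hx)).2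
  have ht := H.total h0
  have hcountQ : (d : ℚ) * 𝓕.card ≤ (n : ℚ) * (2 ^ d - c) := by exact_mod_cast hcount
  have hd0 : (0 : ℚ) < d := by
    have : 0 < d := by omega
    exact_mod_cast this
  rw [hV, h2, ← mul_div_assoc, div_le_iff₀ hd0] at ht
  linarith
end

section
/- Let d ≥ 2 and c be natural numbers with 1 ≤ c ≤ 2^{d−2}. Then W(2^{d−1} − c) ≥ (2^d − 1)/d − c/(d − log₂ c), where the logarithm is to base 2. -/
/-- `colexInit m` is the family of the first `m` finite subsets of `ℕ` in colexicographic
order; a finite set `A ⊆ ℕ` has colexicographic rank `∑ i ∈ A, 2 ^ i`. -/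
def colexInit (m : ℕ) : Finset (Finset ℕ) :=
  (Finset.range m).powerset.filter fun A => ∑ i ∈ A, 2 ^ i < m

/-- `W m = ∑_{R ∈ R(m)} 1/(|R| + 1)`. -/
noncomputable def W (m : ℕ) : ℝ :=
  ∑ R ∈ colexInit m, (1 : ℝ) / (R.card + 1)

theorem two_pow_card_le (R : Finset ℕ) : 2 ^ R.card ≤ 1 + ∑ i ∈ R, 2 ^ i := by
  induction R using Finset.induction_on_max with
  | empty => simp
  | insert a s h ih =>
    have ha : a ∉ s := fun h' => lt_irrefl _ (h a h')
    have hc : s.card ≤ a := by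
      have : s ⊆ Finset.range a := fun x hx => Finset.mem_range.2 (h x hx)
      simpa using Finset.card_le_card this
    have := Nat.pow_le_pow_right (show 0 < 2 by norm_num) hc
    rw [Finset.card_insert_of_notMem ha, Finset.sum_insert ha, pow_succ]
    omega

theorem sum_two_pow_range (n : ℕ) : ∑ i ∈ Finset.range n, 2 ^ i + 1 = 2 ^ n := by
  induction n with
  | zero => simp
  | succ n ih => rw [Finset.sum_range_succ, pow_succ]; omega

theorem colexInit_eq (n m : ℕ) (h : m ≤ 2 ^ n) :
    colexInit m = (Finset.range n).powerset.filter fun A => ∑ i ∈ A, 2 ^ i < m := by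
  ext A
  simp only [colexInit, Finset.mem_filter, Finset.mem_powerset]
  refine and_congr_left fun hA => ?_
  have key : ∀ i ∈ A, 2 ^ i < m := fun i hi =>
    lt_of_le_of_lt (Finset.single_le_sum (f := fun i => 2 ^ i) (fun _ _ => Nat.zero_le _) hi) hA
  constructor
  · intro _ i hi
    exact Finset.mem_range.2 ((Nat.pow_lt_pow_iff_right (by norm_num)).1 ((key i hi).trans_le h))
  · intro _ i hi
    exact Finset.mem_range.2 (Nat.lt_two_pow_self.trans (key i hi))

theorem sum_all (n : ℕ) : ∑ R ∈ (Finset.range n).powerset, (1 : ℝ) / (R.card + 1)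
    = ((2 : ℝ) ^ (n + 1) - 1) / ((n + 1 : ℕ) : ℝ) := by
  rw [Finset.sum_powerset_apply_card (fun k => (1 : ℝ) / (k + 1)), Finset.card_range,
    eq_div_iff (by positivity), Finset.sum_mul]
  have h := Nat.sum_range_choose (n + 1)
  rw [Finset.sum_range_succ'] at h
  have h' : ((∑ k ∈ Finset.range (n + 1), (n + 1).choose (k + 1) : ℕ) : ℝ) + 1
      = (2 : ℝ) ^ (n + 1) := by exact_mod_cast h
  rw [← h', add_sub_cancel_right, Nat.cast_sum]
  refine Finset.sum_congr rfl fun k _ => ?_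
  have := Nat.add_one_mul_choose_eq n k
  have h2 : ((n : ℝ) + 1) * n.choose k = (n + 1).choose (k + 1) * (k + 1) := by
    exact_mod_cast this
  have : (k : ℝ) + 1 ≠ 0 := by positivity
  rw [nsmul_eq_mul]
  push_cast
  field_simp
  linarith

/-- For `d ≥ 2` and `1 ≤ c ≤ 2^{d−2}` we have
`W(2^{d−1} − c) ≥ (2^d − 1)/d − c/(d − log₂ c)`. -/
theorem W_lower_bound (d c : ℕ) (hd : 2 ≤ d) (hc : 1 ≤ c) (hc' : c ≤ 2 ^ (d - 2)) :
    ((2 : ℝ) ^ d - 1) / d - c / (d - Real.logb 2 c) ≤ W (2 ^ (d - 1) - c) := by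
  obtain ⟨n, rfl⟩ : ∃ n, d = n + 1 := ⟨d - 1, by omega⟩
  have hc0 : (0 : ℝ) < c := by exact_mod_cast hc
  have hlog : ∀ k : ℕ, 2 ^ k ≤ c → (k : ℝ) ≤ Real.logb 2 c := fun k hk => by
    rw [Real.le_logb_iff_rpow_le (by norm_num) hc0, Real.rpow_natCast]
    exact_mod_cast hk
  have hpos : 0 < ((n + 1 : ℕ) : ℝ) - Real.logb 2 c := by
    have : Real.logb 2 c ≤ ((n + 1 - 2 : ℕ) : ℝ) := by
      rw [Real.logb_le_iff_le_rpow (by norm_num) hc0, Real.rpow_natCast]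
      exact_mod_cast hc'
    have h2 : ((n + 1 - 2 : ℕ) : ℝ) < ((n + 1 : ℕ) : ℝ) := by
      exact_mod_cast (by omega : n + 1 - 2 < n + 1)
    linarith
  rw [← sum_all, Nat.add_sub_cancel, W, colexInit_eq n _ (Nat.sub_le _ _),
    ← Finset.sum_filter_add_sum_filter_not (Finset.range n).powerset
      (fun A => ∑ i ∈ A, 2 ^ i < 2 ^ n - c)]
  set T := (Finset.range n).powerset.filter (fun A => ¬ ∑ i ∈ A, 2 ^ i < 2 ^ n - c) with hT
  have hrank : ∀ A ∈ (Finset.range n).powerset,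
      ∑ i ∈ Finset.range n \ A, 2 ^ i + ∑ i ∈ A, 2 ^ i + 1 = 2 ^ n := fun A hA => by
    rw [Finset.sum_sdiff (Finset.mem_powerset.1 hA), sum_two_pow_range]
  have hcard : T.card ≤ c := by
    have h1 : T.card ≤ (Finset.Ico (2 ^ n - c) (2 ^ n)).card := by
      refine Finset.card_le_card_of_injOn (fun A => ∑ i ∈ A, 2 ^ i) ?_
        (Finset.geomSum_injective le_rfl).injOn
      intro A hA
      have hA' := Finset.mem_filter.1 (Finset.mem_coe.1 hA)
      have := hrank A hA'.1
      simp only [Finset.coe_Ico, Set.mem_Ico]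
      omega
    rw [Nat.card_Ico] at h1
    omega
  have hterm : ∀ A ∈ T, (1 : ℝ) / (A.card + 1) ≤ 1 / (((n + 1 : ℕ) : ℝ) - Real.logb 2 c) := by
    intro A hA
    have hA' := Finset.mem_filter.1 hA
    have h1 := hrank A hA'.1
    have h2 := two_pow_card_le (Finset.range n \ A)
    have h3 := hlog _ (show 2 ^ (Finset.range n \ A).card ≤ c by omega)
    have h4 := Finset.card_sdiff_add_card_eq_card (Finset.mem_powerset.1 hA'.1)
    rw [Finset.card_range] at h4
    have h5 : ((Finset.range n \ A).card : ℝ) + A.card = n := by exact_mod_cast h4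
    refine one_div_le_one_div_of_le hpos ?_
    push_cast
    linarith
  have hsum := Finset.sum_le_card_nsmul T _ _ hterm
  have : (T.card : ℝ) * (1 / (((n + 1 : ℕ) : ℝ) - Real.logb 2 c))
      ≤ c / (((n + 1 : ℕ) : ℝ) - Real.logb 2 c) := by
    rw [div_eq_mul_one_div (c : ℝ)]
    exact mul_le_mul_of_nonneg_right (by exact_mod_cast hcard) (by positivity)
  rw [nsmul_eq_mul] at hsum
  linarith
end

section
/- Let d ≥ 4 be a natural number and c ∈ {2, 3}, let V be a finite set, and let 𝓗 be a hereditary family of subsets of V with |𝓗| ≥ 2^d − c. Suppose 𝓗 is not isomorphic to R(2^d − c) up to isolated vertices, i.e. there is no injection φ from the set of non-isolated vertices of 𝓗 into ℕ such that {φ[H] : H ∈ 𝓗} = R(2^d − c). Then Σ_{H ∈ 𝓗} 1/(|H| + 1) ≥ W(2^d − c) + min(1/6, 1/d). -/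
/-- A family of finite sets is hereditary if it is closed under taking subsets. -/
def Hereditary {α : Type*} [DecidableEq α] (𝓕 : Finset (Finset α)) : Prop :=
  ∀ F ∈ 𝓕, ∀ F' ⊆ F, F' ∈ 𝓕

/-- Number of binary digits one. -/
def popc (n : ℕ) : ℕ := n.bitIndices.length

lemma popc_zero : popc 0 = 0 := by simp [popc]
lemma popc_two_mul (n : ℕ) : popc (2 * n) = popc n := by simp [popc]
lemma popc_two_mul_add_one (n : ℕ) : popc (2 * n + 1) = popc n + 1 := by simp [popc]

lemma popc_le (k : ℕ) : ∀ n, n < 2 ^ k → popc n ≤ k := by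
  induction k with
  | zero => intro n hn; have : n = 0 := by simpa using hn
            subst this; simp [popc_zero]
  | succ k ih =>
    intro n hn
    rw [pow_succ] at hn
    obtain ⟨m, rfl | rfl⟩ := Nat.even_or_odd' n
    · rw [popc_two_mul]; have := ih m (by omega); omega
    · rw [popc_two_mul_add_one]; have := ih m (by omega); omega

/-- Weight of the initial segment. -/
noncomputable def WF (f : ℕ → ℝ) (m : ℕ) : ℝ := ∑ i ∈ Finset.range m, f (popc i)

lemma WF_zero (f : ℕ → ℝ) : WF f 0 = 0 := by simp [WF]

lemma WF_succ (f : ℕ → ℝ) (m : ℕ) : WF f (m + 1) = WF f m + f (popc m) := by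
  simp [WF, Finset.sum_range_succ]

lemma WF_two_mul (f : ℕ → ℝ) (m : ℕ) :
    WF f (2 * m) = WF f m + WF (fun k => f (k + 1)) m := by
  induction m with
  | zero => simp [WF_zero]
  | succ m ih =>
    rw [show 2 * (m + 1) = 2 * m + 1 + 1 by ring, WF_succ, WF_succ, ih, WF_succ, WF_succ,
      popc_two_mul, popc_two_mul_add_one]
    ring

lemma WF_two_mul_add_one (f : ℕ → ℝ) (m : ℕ) :
    WF f (2 * m + 1) = WF f (m + 1) + WF (fun k => f (k + 1)) m := by
  rw [WF_succ, WF_two_mul, WF_succ, popc_two_mul]; ring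

lemma antitone_shift {f : ℕ → ℝ} (hf : Antitone f) : Antitone (fun k => f (k + 1)) :=
  fun _ _ h => hf (by omega)

lemma WF_add (N : ℕ) : ∀ (a b : ℕ), a + b ≤ N → b ≤ a → ∀ f : ℕ → ℝ, Antitone f →
    WF f (a + b) ≤ WF f a + WF (fun k => f (k + 1)) b := by
  induction N with
  | zero =>
    intro a b h _ f _
    obtain ⟨rfl, rfl⟩ : a = 0 ∧ b = 0 := by omega
    simp [WF_zero]
  | succ N ih =>
    intro a b h hba f hf
    have hf' := antitone_shift hf
    rcases Nat.eq_zero_or_pos b with rfl | hb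
    · simp [WF_zero]
    obtain ⟨p, rfl | rfl⟩ := Nat.even_or_odd' a <;> obtain ⟨q, rfl | rfl⟩ := Nat.even_or_odd' b
    · have h1 := ih p q (by omega) (by omega) f hf
      have h2 := ih p q (by omega) (by omega) _ hf'
      rw [show 2 * p + 2 * q = 2 * (p + q) by ring]
      simp only [WF_two_mul] at *
      linarith
    · have h1 := ih p (q + 1) (by omega) (by omega) f hf
      have h2 := ih p q (by omega) (by omega) _ hf'
      rw [show 2 * p + (2 * q + 1) = 2 * (p + q) + 1 by ring]
      simp only [WF_two_mul, WF_two_mul_add_one] at *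
      rw [show p + (q + 1) = p + q + 1 by ring] at h1
      linarith
    · have h1 := ih (p + 1) q (by omega) (by omega) f hf
      have h2 := ih p q (by omega) (by omega) _ hf'
      rw [show 2 * p + 1 + 2 * q = 2 * (p + q) + 1 by ring]
      simp only [WF_two_mul, WF_two_mul_add_one] at *
      rw [show p + 1 + q = p + q + 1 by ring] at h1
      linarith
    · rcases eq_or_lt_of_le hba with hqp | hqp
      · obtain rfl : q = p := by omega
        rw [← two_mul, WF_two_mul]
      · have h1 := ih (p + 1) q (by omega) (by omega) f hf
        have h2 := ih p (q + 1) (by omega) (by omega) _ hf'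
        rw [show 2 * p + 1 + (2 * q + 1) = 2 * (p + q + 1) by ring]
        simp only [WF_two_mul, WF_two_mul_add_one] at *
        rw [show p + 1 + q = p + q + 1 by ring] at h1
        rw [show p + (q + 1) = p + q + 1 by ring, WF_succ _ q] at h2
        rw [WF_succ _ q]
        have h3 : f (popc q + 1 + 1) ≤ f (popc q + 1) := hf (by omega)
        linarith

lemma WF_le_family {α : Type*} [DecidableEq α] (V : Finset α) :
    ∀ (𝓗 : Finset (Finset α)), 𝓗 ⊆ V.powerset → Hereditary 𝓗 → ∀ f : ℕ → ℝ, Antitone f →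
      WF f 𝓗.card ≤ ∑ H ∈ 𝓗, f H.card := by
  induction V using Finset.induction_on with
  | empty =>
    intro 𝓗 h _ f _
    rw [Finset.powerset_empty, Finset.subset_singleton_iff] at h
    rcases h with rfl | rfl
    · simp [WF_zero]
    · simp [WF, popc_zero]
  | insert v V hv ih =>
    intro 𝓗 h hher f hf
    have hA : 𝓗.nonMemberSubfamily v ⊆ V.powerset := by
      intro H hH
      rw [Finset.mem_nonMemberSubfamily] at hH
      have := Finset.mem_powerset.1 (h hH.1)
      rw [Finset.mem_powerset]
      exact (Finset.subset_insert_iff_of_notMem hH.2).1 this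
    have hBA : 𝓗.memberSubfamily v ⊆ 𝓗.nonMemberSubfamily v := by
      intro H hH
      rw [Finset.mem_memberSubfamily] at hH
      rw [Finset.mem_nonMemberSubfamily]
      exact ⟨hher _ hH.1 _ (Finset.subset_insert _ _), hH.2⟩
    have hAh : Hereditary (𝓗.nonMemberSubfamily v) := by
      intro F hF F' hF'
      rw [Finset.mem_nonMemberSubfamily] at *
      exact ⟨hher _ hF.1 _ hF', fun hh => hF.2 (hF' hh)⟩
    have hBh : Hereditary (𝓗.memberSubfamily v) := by
      intro F hF F' hF'
      rw [Finset.mem_memberSubfamily] at *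
      exact ⟨hher _ hF.1 _ (Finset.insert_subset_insert _ hF'), fun hh => hF.2 (hF' hh)⟩
    have h1 := ih _ hA hAh f hf
    have h2 := ih _ (hBA.trans hA) hBh _ (antitone_shift hf)
    have hc := Finset.card_memberSubfamily_add_card_nonMemberSubfamily v 𝓗
    have h3 := WF_add _ _ _ le_rfl (Finset.card_le_card hBA) f hf
    rw [add_comm, hc] at h3
    have h4 : ∑ H ∈ 𝓗, f H.card = ∑ H ∈ 𝓗.nonMemberSubfamily v, f H.card
        + ∑ H ∈ 𝓗.memberSubfamily v, f (H.card + 1) := by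
      rw [← Finset.sum_filter_add_sum_filter_not 𝓗 (fun H => v ∈ H), add_comm]
      congr 1
      rw [Finset.memberSubfamily, Finset.sum_image]
      · refine Finset.sum_congr rfl fun H hH => ?_
        rw [Finset.card_erase_add_one (Finset.mem_filter.1 hH).2]
      · intro a ha b hb hab
        have ha := (Finset.mem_filter.1 ha).2
        have hb := (Finset.mem_filter.1 hb).2
        have := congrArg (insert v) hab
        simpa [Finset.insert_erase ha, Finset.insert_erase hb] using this
    linarith

lemma sum_colexInit (f : ℕ → ℝ) (m : ℕ) : ∑ R ∈ colexInit m, f R.card = WF f m := by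
  unfold WF
  refine Finset.sum_bij' (fun A _ => ∑ i ∈ A, 2 ^ i) (fun n _ => n.bitIndices.toFinset)
    ?_ ?_ ?_ ?_ ?_
  · intro A hA
    exact Finset.mem_range.2 (Finset.mem_filter.1 hA).2
  · intro n hn
    rw [colexInit, Finset.mem_filter, Finset.sum_toFinset_bitIndices_two_pow]
    refine ⟨?_, Finset.mem_range.1 hn⟩
    rw [Finset.mem_powerset]
    intro i hi
    have h1 : 2 ^ i ≤ ∑ j ∈ n.bitIndices.toFinset, 2 ^ j :=
      Finset.single_le_sum (f := fun j => 2 ^ j) (fun _ _ => Nat.zero_le _) hi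
    rw [Finset.sum_toFinset_bitIndices_two_pow] at h1
    have := Nat.lt_two_pow_self (n := i)
    have := Finset.mem_range.1 hn
    exact Finset.mem_range.2 (by omega)
  · intro A hA
    exact Finset.toFinset_bitIndices_sum_two_pow A
  · intro n hn
    exact Finset.sum_toFinset_bitIndices_two_pow n
  · intro A hA
    congr 1
    rw [popc]
    conv_lhs => rw [← Finset.toFinset_bitIndices_sum_two_pow A]
    exact List.toFinset_card_of_nodup (Nat.bitIndices_sorted).nodup

lemma card_colexInit (m : ℕ) : (colexInit m).card = m := by
  have := sum_colexInit (fun _ => 1) m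
  simpa [WF] using this

lemma WF_mono {f : ℕ → ℝ} (hf : ∀ k, 0 ≤ f k) {a b : ℕ} (h : a ≤ b) : WF f a ≤ WF f b :=
  Finset.sum_le_sum_of_subset_of_nonneg (Finset.range_mono h) fun _ _ _ => hf _

/-- The truncated weight. -/
noncomputable def ft (k : ℕ) : ℝ := 1 / ((max k 2 : ℕ) + 1)

/-- The difference between the weight and the truncated weight. -/
noncomputable def dt (k : ℕ) : ℝ := if k = 0 then 2 / 3 else if k = 1 then 1 / 6 else 0

lemma ft_add_dt (k : ℕ) : (1 : ℝ) / (k + 1) = ft k + dt k := by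
  rcases k with _ | _ | k
  · norm_num [ft, dt]
  · norm_num [ft, dt]
  · simp [ft, dt]

lemma ft_antitone : Antitone ft := by
  intro a b h
  unfold ft
  apply one_div_le_one_div_of_le (by positivity)
  have : max a 2 ≤ max b 2 := max_le_max_right _ h
  have : ((max a 2 : ℕ) : ℝ) ≤ (max b 2 : ℕ) := by exact_mod_cast this
  linarith

lemma dt_nonneg (k : ℕ) : 0 ≤ dt k := by unfold dt; split_ifs <;> norm_num

lemma WF_dt (d : ℕ) : WF dt (2 ^ d) = 2 / 3 + d / 6 := by
  have h0 : ∀ m, WF (fun k => dt (k + 1 + 1)) m = 0 := by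
    intro m; simp [WF, dt]
  have h1 : ∀ d, WF (fun k => dt (k + 1)) (2 ^ d) = 1 / 6 := by
    intro d
    induction d with
    | zero => simp [WF, popc_zero, dt]
    | succ d ih => rw [pow_succ, mul_comm, WF_two_mul, ih, h0]; simp
  induction d with
  | zero => simp [WF, popc_zero, dt]
  | succ d ih => rw [pow_succ, mul_comm, WF_two_mul, ih, h1]; push_cast; ring

lemma W_eq (m : ℕ) : W m = WF (fun k => (1 : ℝ) / (k + 1)) m :=
  sum_colexInit (fun k => (1 : ℝ) / (k + 1)) m

lemma popc_special (d c : ℕ) (hd : 4 ≤ d) (hc : c = 2 ∨ c = 3) : popc (2 ^ d - c) + 1 ≤ d := by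
  obtain ⟨e, rfl⟩ : ∃ e, d = e + 2 := ⟨d - 2, by omega⟩
  have hp : 1 ≤ 2 ^ e := Nat.one_le_two_pow
  rcases hc with rfl | rfl
  · rw [show 2 ^ (e + 2) - 2 = 2 * (2 * 2 ^ e - 1) by rw [pow_add]; omega, popc_two_mul]
    have := popc_le (e + 1) (2 * 2 ^ e - 1) (by rw [pow_succ]; omega)
    omega
  · rw [show 2 ^ (e + 2) - 3 = 2 * (2 * (2 ^ e - 1)) + 1 by rw [pow_add]; omega,
      popc_two_mul_add_one, popc_two_mul]
    have := popc_le e (2 ^ e - 1) (by omega)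
    omega

lemma one_div_antitone : Antitone (fun k : ℕ => (1 : ℝ) / (k + 1)) := by
  intro a b h
  apply one_div_le_one_div_of_le (by positivity)
  have : (a : ℝ) ≤ b := by exact_mod_cast h
  linarith

lemma exists_enum {α : Type*} [DecidableEq α] (U T : Finset α) (hT : T ⊆ U) :
    ∃ φ : α → ℕ, Set.InjOn φ U ∧ (∀ u ∈ U, φ u < U.card) ∧
      (∀ u ∈ U, φ u < T.card → u ∈ T) := by
  classical
  have e1 := T.equivFin
  have e2 := (U \ T).equivFin
  have hcard : (U \ T).card + T.card = U.card := Finset.card_sdiff_add_card_eq_card hT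
  refine ⟨fun u => if h : u ∈ T then (e1 ⟨u, h⟩ : ℕ) else
    if h' : u ∈ U \ T then T.card + (e2 ⟨u, h'⟩ : ℕ) else 0, ?_, ?_, ?_⟩
  · intro a ha b hb hab
    have ha : a ∈ U := ha
    have hb : b ∈ U := hb
    by_cases haT : a ∈ T <;> by_cases hbT : b ∈ T
    · simp only [haT, hbT, dif_pos] at hab
      have := e1.injective (Fin.ext hab)
      exact congrArg Subtype.val this
    · have hb' : b ∈ U \ T := Finset.mem_sdiff.2 ⟨hb, hbT⟩
      simp only [haT, hbT, hb', dif_pos, dif_neg, not_false_eq_true] at hab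
      have := (e1 ⟨a, haT⟩).2
      omega
    · have ha' : a ∈ U \ T := Finset.mem_sdiff.2 ⟨ha, haT⟩
      simp only [haT, hbT, ha', dif_pos, dif_neg, not_false_eq_true] at hab
      have := (e1 ⟨b, hbT⟩).2
      omega
    · have ha' : a ∈ U \ T := Finset.mem_sdiff.2 ⟨ha, haT⟩
      have hb' : b ∈ U \ T := Finset.mem_sdiff.2 ⟨hb, hbT⟩
      simp only [haT, hbT, ha', hb', dif_pos, dif_neg, not_false_eq_true] at hab
      have hv : (e2 ⟨a, ha'⟩ : ℕ) = e2 ⟨b, hb'⟩ := by omega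
      have := e2.injective (Fin.ext hv)
      exact congrArg Subtype.val this
  · intro u hu
    by_cases huT : u ∈ T
    · simp only [huT, dif_pos]
      have := (e1 ⟨u, huT⟩).2
      omega
    · have hu' : u ∈ U \ T := Finset.mem_sdiff.2 ⟨hu, huT⟩
      simp only [huT, hu', dif_pos, dif_neg, not_false_eq_true]
      have := (e2 ⟨u, hu'⟩).2
      omega
  · intro u hu hlt
    by_contra huT
    have hu' : u ∈ U \ T := Finset.mem_sdiff.2 ⟨hu, huT⟩
    simp only [huT, hu', dif_pos, dif_neg, not_false_eq_true] at hlt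
    omega

lemma exists_iso {α : Type*} [DecidableEq α] (d c : ℕ)
    (hd : 4 ≤ d) (hc : c = 2 ∨ c = 3) (U : Finset α)
    (𝓗 : Finset (Finset α)) (h𝓗 : 𝓗 ⊆ U.powerset) (hher : Hereditary 𝓗)
    (hU : U.card = d) (hcard : 𝓗.card = 2 ^ d - c) :
    ∃ φ : α → ℕ, Set.InjOn φ U ∧ (𝓗.image fun H => H.image φ) = colexInit (2 ^ d - c) := by
  classical
  have hpow : 2 ^ 4 ≤ 2 ^ d := Nat.pow_le_pow_right (by norm_num) hd
  set S := U.filter (fun x => U.erase x ∉ 𝓗) with hS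
  have hM : (U.powerset \ 𝓗).card = c := by
    rw [Finset.card_sdiff_of_subset h𝓗, Finset.card_powerset, hU, hcard]; omega
  have hMS : (U.powerset \ 𝓗).card ≤ S.powerset.card := by
    apply Finset.card_le_card_of_injOn (fun M => U \ M)
    · intro M hM
      have hM := Finset.mem_sdiff.1 hM
      have hMU := Finset.mem_powerset.1 hM.1
      refine Finset.mem_coe.2 (Finset.mem_powerset.2 fun y hy => ?_)
      have hy := Finset.mem_sdiff.1 hy
      refine Finset.mem_filter.2 ⟨hy.1, fun hh => hM.2 (hher _ hh _ ?_)⟩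
      exact Finset.subset_erase.2 ⟨hMU, hy.2⟩
    · intro A hA B hB hAB
      have hA := Finset.mem_powerset.1 (Finset.mem_sdiff.1 hA).1
      have hB := Finset.mem_powerset.1 (Finset.mem_sdiff.1 hB).1
      have := congrArg (fun X => U \ X) hAB
      simpa [Finset.sdiff_sdiff_eq_self hA, Finset.sdiff_sdiff_eq_self hB] using this
  rw [hM, Finset.card_powerset] at hMS
  have hSc : c - 1 ≤ S.card := by
    by_contra hlt
    have : S.card = 0 ∨ S.card = 1 := by omega
    rcases this with h | h <;> rw [h] at hMS <;> omega
  obtain ⟨T, hTS, hTc⟩ := Finset.exists_subset_card_eq hSc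
  have hTU : T ⊆ U := hTS.trans (Finset.filter_subset _ _)
  obtain ⟨φ, hinj, hlt, hTm⟩ := exists_enum U T hTU
  refine ⟨φ, hinj, ?_⟩
  have himU : U.image φ = Finset.range d := by
    apply Finset.eq_of_subset_of_card_le
    · intro i hi
      obtain ⟨u, hu, rfl⟩ := Finset.mem_image.1 hi
      exact Finset.mem_range.2 (hU ▸ hlt u hu)
    · rw [Finset.card_image_of_injOn hinj, hU, Finset.card_range]
  have hsumU : ∑ u ∈ U, 2 ^ φ u = 2 ^ d - 1 := by
    rw [← Finset.sum_image (f := fun i => 2 ^ i) hinj, himU, Nat.geomSum_eq (le_refl 2)]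
    simp
  apply Finset.eq_of_subset_of_card_le
  · intro A hA
    obtain ⟨H, hH, rfl⟩ := Finset.mem_image.1 hA
    have hHU := Finset.mem_powerset.1 (h𝓗 hH)
    have hkey : ∀ u ∈ S, ¬ (U \ H ⊆ {u}) := by
      intro u hu hsub
      refine (Finset.mem_filter.1 hu).2 (hher _ hH _ fun y hy => ?_)
      have hy := Finset.mem_erase.1 hy
      by_contra hyH
      exact hy.1 (Finset.mem_singleton.1 (hsub (Finset.mem_sdiff.2 ⟨hy.2, hyH⟩)))
    have hcomp : c ≤ ∑ u ∈ U \ H, 2 ^ φ u := by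
      by_contra hlt2
      have hle : ∀ u ∈ U \ H, u ∈ T := by
        intro u hu
        have h1 : 2 ^ φ u ≤ ∑ u ∈ U \ H, 2 ^ φ u :=
          Finset.single_le_sum (f := fun u => 2 ^ φ u) (fun _ _ => Nat.zero_le _) hu
        apply hTm u (Finset.mem_sdiff.1 hu).1
        rw [hTc]
        have := Nat.lt_two_pow_self (n := φ u)
        omega
      have hex : ∃ u ∈ S, U \ H ⊆ {u} := by
        rcases (U \ H).eq_empty_or_nonempty with h0 | ⟨u, hu⟩
        · have : T.Nonempty := Finset.card_pos.1 (by omega)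
          obtain ⟨t, ht⟩ := this
          exact ⟨t, hTS ht, by simp [h0]⟩
        · refine ⟨u, hTS (hle u hu), fun y hy => ?_⟩
          by_contra hne
          have hne : y ≠ u := fun h => hne (Finset.mem_singleton.2 h)
          have h2 : ∑ z ∈ ({y, u} : Finset α), 2 ^ φ z ≤ ∑ z ∈ U \ H, 2 ^ φ z := by
            apply Finset.sum_le_sum_of_subset
            intro z hz
            rcases Finset.mem_insert.1 hz with rfl | hz
            · exact hy
            · rw [Finset.mem_singleton.1 hz]; exact hu
          rw [Finset.sum_pair hne] at h2
          have hphi : φ y ≠ φ u := fun h =>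
            hne (hinj (Finset.mem_sdiff.1 hy).1 (Finset.mem_sdiff.1 hu).1 h)
          have a1 := Nat.lt_two_pow_self (n := φ y)
          have a2 := Nat.lt_two_pow_self (n := φ u)
          omega
      obtain ⟨u, hu, hs⟩ := hex
      exact hkey u hu hs
    have hsum : ∑ i ∈ H.image φ, 2 ^ i < 2 ^ d - c := by
      rw [Finset.sum_image (hinj.mono (by exact_mod_cast hHU))]
      have := Finset.sum_sdiff (f := fun u => 2 ^ φ u) hHU
      omega
    refine Finset.mem_filter.2 ⟨?_, hsum⟩
    rw [Finset.mem_powerset]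
    intro i hi
    have h1 : 2 ^ i ≤ ∑ j ∈ H.image φ, 2 ^ j :=
      Finset.single_le_sum (f := fun j => 2 ^ j) (fun _ _ => Nat.zero_le _) hi
    have := Nat.lt_two_pow_self (n := i)
    exact Finset.mem_range.2 (by omega)
  · rw [card_colexInit, Finset.card_image_of_injOn, hcard]
    intro A hA B hB hAB
    have hA := Finset.mem_powerset.1 (h𝓗 hA)
    have hB := Finset.mem_powerset.1 (h𝓗 hB)
    exact (Finset.image_injOn_powerset_of_injOn hinj) (Finset.mem_coe.2 (Finset.mem_powerset.2 hA))
      (Finset.mem_coe.2 (Finset.mem_powerset.2 hB)) hAB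

/-- Lemma 3.1(3): let `d ≥ 4` and `c ∈ {2, 3}`, and let `𝓗` be a hereditary family with
`|𝓗| ≥ 2^d − c` which is not isomorphic (up to isolated vertices) to `R(2^d − c)`, i.e.
there is no map `φ` injective on the non-isolated vertices of `𝓗` with
`{φ[H] : H ∈ 𝓗} = R(2^d − c)`. Then
`∑_{H ∈ 𝓗} 1/(|H| + 1) ≥ W(2^d − c) + min(1/6, 1/d)`. -/
theorem weight_lemma_noniso {α : Type*} [DecidableEq α] (d c : ℕ)
    (hd : 4 ≤ d) (hc : c = 2 ∨ c = 3) (V : Finset α)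
    (𝓗 : Finset (Finset α)) (h𝓗 : 𝓗 ⊆ V.powerset) (hher : Hereditary 𝓗)
    (hcard : 2 ^ d - c ≤ 𝓗.card)
    (hnoniso : ¬ ∃ φ : α → ℕ,
      Set.InjOn φ {v : α | ∃ H ∈ 𝓗, v ∈ H} ∧
      (𝓗.image fun H => H.image φ) = colexInit (2 ^ d - c)) :
    W (2 ^ d - c) + min (1 / 6 : ℝ) (1 / d) ≤ ∑ H ∈ 𝓗, (1 : ℝ) / (H.card + 1) := by
  have hpow : 2 ^ 4 ≤ 2 ^ d := Nat.pow_le_pow_right (by norm_num) hd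
  rcases Nat.lt_or_ge (2 ^ d - c) 𝓗.card with hgt | hle
  · have h1 := WF_le_family V 𝓗 h𝓗 hher _ one_div_antitone
    have h2 := WF_mono (f := fun k : ℕ => (1 : ℝ) / (k + 1)) (fun k => by positivity)
      (Nat.succ_le_of_lt hgt)
    rw [Nat.succ_eq_add_one, WF_succ, ← W_eq] at h2
    have h3 : (1 : ℝ) / d ≤ 1 / ((popc (2 ^ d - c) : ℝ) + 1) := by
      apply one_div_le_one_div_of_le (by positivity)
      exact_mod_cast popc_special d c hd hc
    have h4 : min (1 / 6 : ℝ) (1 / d) ≤ 1 / d := min_le_right _ _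
    linarith
  have hm : 𝓗.card = 2 ^ d - c := le_antisymm hle hcard
  set U := 𝓗.sup id with hU
  have hmemU : ∀ v, v ∈ U ↔ ∃ H ∈ 𝓗, v ∈ H := by intro v; simp [hU, Finset.mem_sup]
  have hHU : 𝓗 ⊆ U.powerset := by
    intro H hH
    exact Finset.mem_powerset.2 fun v hv => (hmemU v).2 ⟨H, hH, hv⟩
  have hUd : d ≤ U.card := by
    by_contra hlt
    have h1 := Finset.card_le_card hHU
    rw [Finset.card_powerset] at h1
    have h2 : 2 ^ U.card ≤ 2 ^ (d - 1) := Nat.pow_le_pow_right (by norm_num) (by omega)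
    have h3 : 2 ^ d = 2 * 2 ^ (d - 1) := by rw [← pow_succ']; congr 1; omega
    omega
  rcases eq_or_lt_of_le hUd with heq | hlt
  · exfalso
    obtain ⟨φ, hi, he⟩ := exists_iso d c hd hc U 𝓗 hHU hher heq.symm hm
    refine hnoniso ⟨φ, ?_, he⟩
    intro a ha b hb hab
    exact hi ((hmemU a).2 ha) ((hmemU b).2 hb) hab
  · have h1 := WF_le_family V 𝓗 h𝓗 hher ft ft_antitone
    rw [hm] at h1
    have h2 : W (2 ^ d - c) = WF ft (2 ^ d - c) + WF dt (2 ^ d - c) := by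
      rw [W_eq, WF, WF, WF, ← Finset.sum_add_distrib]
      exact Finset.sum_congr rfl fun i _ => ft_add_dt _
    have h3 : WF dt (2 ^ d - c) ≤ 2 / 3 + d / 6 := by
      rw [← WF_dt]; exact WF_mono dt_nonneg (Nat.sub_le _ _)
    have h4 : ∑ H ∈ 𝓗, (1 : ℝ) / (H.card + 1) = ∑ H ∈ 𝓗, ft H.card + ∑ H ∈ 𝓗, dt H.card := by
      rw [← Finset.sum_add_distrib]
      exact Finset.sum_congr rfl fun i _ => ft_add_dt _
    have h5 : (2 : ℝ) / 3 + U.card / 6 ≤ ∑ H ∈ 𝓗, dt H.card := by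
      have hsub : insert ∅ (U.image fun u => ({u} : Finset α)) ⊆ 𝓗 := by
        intro H hH
        rcases Finset.mem_insert.1 hH with rfl | hH
        · obtain ⟨X, hX⟩ : 𝓗.Nonempty := Finset.card_pos.1 (by omega)
          exact hher X hX _ (Finset.empty_subset _)
        · obtain ⟨u, hu, rfl⟩ := Finset.mem_image.1 hH
          obtain ⟨X, hX, huX⟩ := (hmemU u).1 hu
          exact hher X hX _ (Finset.singleton_subset_iff.2 huX)
      refine le_trans (le_of_eq ?_) (Finset.sum_le_sum_of_subset_of_nonneg hsub
        fun _ _ _ => dt_nonneg _)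
      rw [Finset.sum_insert (by simp), Finset.sum_image (by intro a _ b _ h; simpa using h)]
      simp [dt]
      ring
    have h6 : (d : ℝ) + 1 ≤ U.card := by exact_mod_cast hlt
    have h7 : min (1 / 6 : ℝ) (1 / d) ≤ 1 / 6 := min_le_left _ _
    linarith
end
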